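/- arXiv:2505.06572 — 3 statements merged into one kernel-verified Lean document; each statement's English description precedes it below -/
import Mathlib

section
/- Let p ≥ 1 and let K ⊆ ℝ^p be the union of finitely many pairwise distinct nonempty compact sets K_1, …, K_q with q ≥ 3, each not reduced to a point, such that K_i ∩ K_{i+1} ≠ ∅ for every 1 ≤ i ≤ q−1 and diam(K) = Σ_{j=1}^q diam(K_j). Then no point of K belongs to three distinct sets K_j. -/
/-- Along a chain of bounded sets, consecutive ones meeting, the distance between two points is at
most the sum of the diameters of the sets between them. -/
theorem dist_le_sum_diam_of_chain {X : Type*} [PseudoMetricSpace X] {q : ℕ} {K : Fin q → Set X}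
    (hb : ∀ i, Bornology.IsBounded (K i))
    (hconsec : ∀ i : ℕ, ∀ hi : i + 1 < q,
      (K ⟨i, Nat.lt_of_succ_lt hi⟩ ∩ K ⟨i + 1, hi⟩).Nonempty)
    {s t : Fin q} (hst : s ≤ t) {a b : X} (ha : a ∈ K s) (hbt : b ∈ K t) :
    dist a b ≤ ∑ j ∈ Finset.Icc s t, Metric.diam (K j) := by
  obtain ⟨t, ht⟩ := t
  have hst' : (s : ℕ) ≤ t := hst
  clear hst
  induction t, hst' using Nat.le_induction generalizing b with
  | base => simpa using Metric.dist_le_diam_of_mem (hb s) ha hbt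
  | succ n hn ih =>
    obtain ⟨y, hy, hy'⟩ := hconsec n ht
    have hIcc : Finset.Icc s ⟨n + 1, ht⟩ =
        insert ⟨n + 1, ht⟩ (Finset.Icc s ⟨n, Nat.lt_of_succ_lt ht⟩) := by
      ext j
      simp only [Finset.mem_Icc, Finset.mem_insert, Fin.le_def, Fin.ext_iff]
      omega
    rw [hIcc, Finset.sum_insert (by simp [Fin.le_def])]
    linarith [dist_triangle a y b, ih (Nat.lt_of_succ_lt ht) hy,
      Metric.dist_le_diam_of_mem (hb _) hy' hbt]

/-- The diameter of a nonempty compact set is attained. -/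
theorem IsCompact.exists_diam_le_dist {X : Type*} [PseudoMetricSpace X] {S : Set X}
    (hS : IsCompact S) (hne : S.Nonempty) : ∃ a ∈ S, ∃ b ∈ S, Metric.diam S ≤ dist a b := by
  obtain ⟨⟨a, b⟩, ⟨ha, hb⟩, hmax⟩ := (hS.prod hS).exists_isMaxOn (hne.prod hne)
    (f := fun z : X × X => dist z.1 z.2) (by fun_prop)
  exact ⟨a, ha, b, hb, Metric.diam_le_of_forall_dist_le dist_nonneg
    fun x hx y hy => hmax (Set.mk_mem_prod hx hy)⟩

/-- If the diameter of a chain of nondegenerate compact sets is the sum of the diameters of its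
links, then no point lies in three links. -/
theorem not_mem_three_of_diam_iUnion_eq_sum {X : Type*} [PseudoMetricSpace X] {q : ℕ}
    {K : Fin q → Set X} (hcpt : ∀ i, IsCompact (K i)) (hpos : ∀ i, 0 < Metric.diam (K i))
    (hconsec : ∀ i : ℕ, ∀ hi : i + 1 < q,
      (K ⟨i, Nat.lt_of_succ_lt hi⟩ ∩ K ⟨i + 1, hi⟩).Nonempty)
    (hdiam : Metric.diam (⋃ i, K i) = ∑ i, Metric.diam (K i))
    {x : X} {i j k : Fin q} (hij : i < j) (hjk : j < k) (hi : x ∈ K i) (hk : x ∈ K k) : False := by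
  have hb := fun i => (hcpt i).isBounded
  have sum_lt : ∀ (A : Finset (Fin q)) (m : Fin q), m ∉ A →
      ∑ l ∈ A, Metric.diam (K l) < ∑ l, Metric.diam (K l) := fun A m hm =>
    Finset.sum_lt_sum_of_subset A.subset_univ (Finset.mem_univ m) hm (hpos m)
      fun l _ _ => (hpos l).le
  obtain ⟨a, ha, b, hbK, hab⟩ :=
    (isCompact_iUnion hcpt).exists_diam_le_dist ⟨x, Set.mem_iUnion_of_mem i hi⟩
  obtain ⟨s, hs⟩ := Set.mem_iUnion.1 ha
  obtain ⟨t, ht⟩ := Set.mem_iUnion.1 hbK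
  clear ha hbK
  wlog hst : s ≤ t generalizing a b s t
  · exact this b a (by rwa [dist_comm]) t ht s hs (le_of_not_ge hst)
  have hall : ∀ m, m ∈ Finset.Icc s t := fun m => by
    by_contra hm
    linarith [sum_lt _ m hm, dist_le_sum_diam_of_chain hb hconsec hst hs ht]
  have hax := dist_le_sum_diam_of_chain hb hconsec (Finset.mem_Icc.1 (hall i)).1 hs hi
  have hxb := dist_le_sum_diam_of_chain hb hconsec (Finset.mem_Icc.1 (hall k)).2 hk ht
  have hdisj : Disjoint (Finset.Icc s i) (Finset.Icc k t) := by
    rw [Finset.disjoint_left]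
    intro l hl hl'
    exact absurd ((Finset.mem_Icc.1 hl').1.trans (Finset.mem_Icc.1 hl).2)
      (not_le.2 (hij.trans hjk))
  have hlt := sum_lt (Finset.Icc s i ∪ Finset.Icc k t) j (by simp [hij, hjk])
  rw [Finset.sum_union hdisj] at hlt
  linarith [dist_triangle a x b]


/--
Let `p ≥ 1` and let `K ⊆ ℝ^p` be the union of finitely many pairwise
distinct nonempty compact sets `K_1, …, K_q` with `q ≥ 3`, each not reduced to a point,
such that `K_i ∩ K_{i+1} ≠ ∅` for every `1 ≤ i ≤ q − 1` and
`diam(K) = Σ_{j=1}^q diam(K_j)`. Then no point of `K` belongs to three distinct sets `K_j`.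
-/
theorem stmt0 (p q : ℕ) (hp : 1 ≤ p) (hq : 3 ≤ q)
    (K : Fin q → Set (EuclideanSpace ℝ (Fin p)))
    (hne : ∀ i, (K i).Nonempty)
    (hcpt : ∀ i, IsCompact (K i))
    (hdist : ∀ i j, i ≠ j → K i ≠ K j)
    (hnotpt : ∀ i, ∃ x ∈ K i, ∃ y ∈ K i, x ≠ y)
    (hconsec : ∀ i : ℕ, ∀ hi : i + 1 < q,
      (K ⟨i, Nat.lt_of_succ_lt hi⟩ ∩ K ⟨i + 1, hi⟩).Nonempty)
    (hdiam : Metric.diam (⋃ i, K i) = ∑ i, Metric.diam (K i)) :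
    ¬ ∃ x ∈ ⋃ i, K i, ∃ i j k : Fin q,
      i ≠ j ∧ j ≠ k ∧ i ≠ k ∧ x ∈ K i ∧ x ∈ K j ∧ x ∈ K k := by
  have hpos : ∀ i, 0 < Metric.diam (K i) := fun i => by
    obtain ⟨x, hx, y, hy, hxy⟩ := hnotpt i
    exact (dist_pos.2 hxy).trans_le (Metric.dist_le_diam_of_mem (hcpt i).isBounded hx hy)
  have key : ∀ x {i j k : Fin q}, i < j → j < k → x ∈ K i → x ∈ K k → False := fun x _ _ _ =>
    not_mem_three_of_diam_iUnion_eq_sum hcpt hpos hconsec hdiam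
  rintro ⟨x, -, i, j, k, hij, hjk, hik, hi, hj, hk⟩
  rcases lt_or_gt_of_ne hij with hij | hij <;> rcases lt_or_gt_of_ne hjk with hjk | hjk <;>
    rcases lt_or_gt_of_ne hik with hik | hik
  · exact key x hij hjk hi hk
  · exact key x hij hjk hi hk
  · exact key x hik hjk hi hj
  · exact key x hik hij hk hj
  · exact key x hij hik hj hk
  · exact key x hjk hik hj hi
  · exact key x hjk hij hk hi
  · exact key x hjk hij hk hi
end

section
/- Let (X,d) be a metric space and let K_1, …, K_q be finitely many nonempty compact subsets of X whose union ⋃_{j=1}^q K_j is connected. Then diam(⋃_{j=1}^q K_j) ≤ Σ_{j=1}^q diam(K_j). -/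
open MeasureTheory in
/-- The distance between two points of a connected set is at most the sum of the diameters of the
members of any finite cover of that set: the distance from the first point maps the set onto an
interval, whose length is controlled by countable subadditivity of Lebesgue measure. -/
theorem IsPreconnected.edist_le_sum_ediam {X ι : Type*} [PseudoMetricSpace X] [Fintype ι]
    {K : ι → Set X} (hK : IsPreconnected (⋃ i, K i)) {x y : X}
    (hx : x ∈ ⋃ i, K i) (hy : y ∈ ⋃ i, K i) :
    edist x y ≤ ∑ i, Metric.ediam (K i) := by
  have hf : LipschitzWith 1 (dist x) := LipschitzWith.dist_right x
  have hsub : Set.Icc 0 (dist x y) ⊆ ⋃ i, dist x '' K i := by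
    rw [← Set.image_iUnion]
    have h := (hK.image _ hf.continuous.continuousOn).Icc_subset
      (Set.mem_image_of_mem _ hx) (Set.mem_image_of_mem _ hy)
    rwa [dist_self] at h
  calc edist x y = volume (Set.Icc 0 (dist x y)) := by
        rw [Real.volume_Icc, sub_zero, edist_dist]
    _ ≤ volume (⋃ i, dist x '' K i) := measure_mono hsub
    _ ≤ ∑ i, volume (dist x '' K i) := measure_iUnion_fintype_le _ _
    _ ≤ ∑ i, Metric.ediam (K i) := Finset.sum_le_sum fun i _ =>
        (Real.volume_le_diam _).trans (by simpa using hf.ediam_image_le (K i))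

/--
Let `(X, d)` be a metric space and let `K_1, …, K_q` be finitely many
nonempty compact subsets of `X` whose union is connected. Then
`diam(⋃_{j=1}^q K_j) ≤ Σ_{j=1}^q diam(K_j)`.
-/
theorem stmt2 {X : Type*} [MetricSpace X] (q : ℕ) (K : Fin q → Set X)
    (hne : ∀ i, (K i).Nonempty)
    (hcpt : ∀ i, IsCompact (K i))
    (hconn : IsConnected (⋃ i, K i)) :
    Metric.diam (⋃ i, K i) ≤ ∑ i, Metric.diam (K i) := by
  have hfin : ∀ i ∈ Finset.univ, Metric.ediam (K i) ≠ ⊤ :=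
    fun i _ => (hcpt i).isBounded.ediam_ne_top
  have hle : Metric.ediam (⋃ i, K i) ≤ ∑ i, Metric.ediam (K i) :=
    Metric.ediam_le fun _ hx _ hy => hconn.isPreconnected.edist_le_sum_ediam hx hy
  simp only [Metric.diam]
  rw [← ENNReal.toReal_sum hfin]
  exact ENNReal.toReal_mono (ENNReal.sum_ne_top.2 hfin) hle
end

section
/- Let U ⊆ ℂ be a nonempty connected open set and let f be holomorphic on U with f′ nonvanishing on U. Then the Schwarzian derivative S(f) vanishes identically on U if and only if f is the restriction to U of a Möbius transformation, i.e. there exist a, b, c, d ∈ ℂ with ad − bc ≠ 0 such that cz + d ≠ 0 and f(z) = (az + b)/(cz + d) for every z ∈ U. -/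
/-- The Schwarzian derivative `S(f)(z) = f‴(z)/f′(z) − (3/2)·(f″(z)/f′(z))²`. -/
noncomputable def schwarzian (f : ℂ → ℂ) (z : ℂ) : ℂ :=
  iteratedDeriv 3 f z / deriv f z - (3 / 2) * (iteratedDeriv 2 f z / deriv f z) ^ 2

theorem IsOpen.exists_const_of_hasDerivAt_zero {U : Set ℂ} (hU : IsOpen U)
    (hconn : IsPreconnected U) {F : ℂ → ℂ} (hF : ∀ z ∈ U, HasDerivAt F 0 z) :
    ∃ k, ∀ z ∈ U, F z = k :=
  hU.exists_is_const_of_deriv_eq_zero hconn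
    (fun z hz => (hF z hz).differentiableAt.differentiableWithinAt) fun z hz => (hF z hz).deriv

theorem IsOpen.hasDerivAt_of_eqOn {U : Set ℂ} (hU : IsOpen U) {F G : ℂ → ℂ} {G' z : ℂ}
    (hFG : Set.EqOn F G U) (hz : z ∈ U) (hG : HasDerivAt G G' z) : HasDerivAt F G' z :=
  hG.congr_of_eventuallyEq (hFG.eventuallyEq_of_mem (hU.mem_nhds hz))

/-- If `f (c z + d) = a z + b`, then `f' (c z + d) ^ 2 = a d - b c`. -/
theorem deriv_mul_sq_of_mul_eq {U : Set ℂ} (hU : IsOpen U) {f : ℂ → ℂ} {a b c d f' z : ℂ}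
    (h : ∀ z ∈ U, f z * (c * z + d) = a * z + b) (hz : z ∈ U) (hf : HasDerivAt f f' z) :
    f' * (c * z + d) ^ 2 = a * d - b * c := by
  have h₁ := hf.mul (((hasDerivAt_id z).const_mul c).add_const d)
  have h₂ := hU.hasDerivAt_of_eqOn (F := fun w => f w * (c * w + d)) h hz
    (((hasDerivAt_id z).const_mul a).add_const b)
  have h₃ := h₁.unique h₂
  simp only [id, mul_one] at h₃
  linear_combination (c * z + d) * h₃ - c * h z hz

theorem schwarzian_eq_zero_of_eqOn_div {U : Set ℂ} (hU : IsOpen U) {f : ℂ → ℂ} {a b c d : ℂ}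
    (hw : ∀ z ∈ U, c * z + d ≠ 0)
    (h : ∀ z ∈ U, f z = (a * z + b) / (c * z + d)) {z : ℂ} (hz : z ∈ U) :
    schwarzian f z = 0 := by
  have lin (a b z : ℂ) : HasDerivAt (fun z => a * z + b) a z := by
    simpa using ((hasDerivAt_id z).const_mul a).add_const b
  have h₁ : Set.EqOn (deriv f) (fun z => (a * d - b * c) / (c * z + d) ^ 2) U := by
    intro z hz
    refine (hU.hasDerivAt_of_eqOn h hz
      (((lin a b z).div (lin c d z) (hw z hz)).congr_deriv ?_)).deriv
    ring
  have h₂ : Set.EqOn (deriv (deriv f))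
      (fun z => -2 * c * (a * d - b * c) / (c * z + d) ^ 3) U := by
    intro z hz
    have := hw z hz
    refine (hU.hasDerivAt_of_eqOn h₁ hz ((((hasDerivAt_const z (a * d - b * c)).div
      ((lin c d z).pow 2) (pow_ne_zero 2 this))).congr_deriv ?_)).deriv
    simp only [Pi.pow_apply]
    field_simp
    push_cast
    ring
  have h₃ : deriv (deriv (deriv f)) z = 6 * c ^ 2 * (a * d - b * c) / (c * z + d) ^ 4 := by
    have := hw z hz
    refine (hU.hasDerivAt_of_eqOn h₂ hz ((((hasDerivAt_const z (-2 * c * (a * d - b * c))).div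
      ((lin c d z).pow 3) (pow_ne_zero 3 this))).congr_deriv ?_)).deriv
    simp only [Pi.pow_apply]
    field_simp
    push_cast
    ring
  have := hw z hz
  simp only [schwarzian, iteratedDeriv_succ, iteratedDeriv_zero]
  rw [h₃, h₂ hz, h₁ hz]
  field_simp
  ring

/-- If the Schwarzian derivative vanishes, then `f''² / f'³` is a constant `K`, and both
`f'' / f'²` and `f f'' / f'²` are affine, the former with slope `-K / 2`. -/
theorem exists_affine_of_schwarzian_eq_zero {U : Set ℂ} (hU : IsOpen U)
    (hconn : IsPreconnected U) {f : ℂ → ℂ} (hf : DifferentiableOn ℂ f U)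
    (hf' : ∀ z ∈ U, deriv f z ≠ 0) (hS : ∀ z ∈ U, schwarzian f z = 0) :
    ∃ K a b d : ℂ, ∀ z ∈ U, deriv (deriv f) z ^ 2 / deriv f z ^ 3 = K ∧
      deriv (deriv f) z / deriv f z ^ 2 = -K / 2 * z + d ∧
      f z * (deriv (deriv f) z / deriv f z ^ 2) = a * z + b := by
  have der {F : ℂ → ℂ} (hF : DifferentiableOn ℂ F U) (z : ℂ) (hz : z ∈ U) :
      HasDerivAt F (deriv F z) z := (hF.differentiableAt (hU.mem_nhds hz)).hasDerivAt
  have d₀ := der hf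
  have d₁ := der (hf.deriv hU)
  have d₂ := der ((hf.deriv hU).deriv hU)
  have hode : ∀ z ∈ U, deriv (deriv (deriv f)) z =
      3 / 2 * deriv (deriv f) z ^ 2 / deriv f z := by
    intro z hz
    have h := hS z hz
    have := hf' z hz
    simp only [schwarzian, iteratedDeriv_succ, iteratedDeriv_zero] at h
    field_simp at h ⊢
    linear_combination h
  obtain ⟨K, hK⟩ := hU.exists_const_of_hasDerivAt_zero hconn
    (F := fun z => deriv (deriv f) z ^ 2 / deriv f z ^ 3) fun z hz => by
      have := hf' z hz
      refine (((d₂ z hz).pow 2).div ((d₁ z hz).pow 3) (pow_ne_zero 3 this)).congr_deriv ?_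
      simp only [Pi.pow_apply]
      rw [hode z hz]
      field_simp
      push_cast
      ring
  have hQ : ∀ z ∈ U, HasDerivAt (fun z => deriv (deriv f) z / deriv f z ^ 2) (-K / 2) z := by
    intro z hz
    have := hf' z hz
    refine ((d₂ z hz).div ((d₁ z hz).pow 2) (pow_ne_zero 2 this)).congr_deriv ?_
    simp only [Pi.pow_apply]
    rw [hode z hz, ← hK z hz]
    field_simp
    push_cast
    ring
  have lin (k z : ℂ) : HasDerivAt (fun z => k * z) k z := by
    simpa using (hasDerivAt_id z).const_mul k
  obtain ⟨d, hd⟩ := hU.exists_const_of_hasDerivAt_zero hconn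
    (F := fun z => deriv (deriv f) z / deriv f z ^ 2 - -K / 2 * z) fun z hz =>
      ((hQ z hz).sub (lin _ z)).congr_deriv (sub_self _)
  obtain ⟨a, ha⟩ := hU.exists_const_of_hasDerivAt_zero hconn
    (F := fun z => deriv (deriv f) z / deriv f z - K / 2 * f z) fun z hz => by
      have := hf' z hz
      refine (((d₂ z hz).div (d₁ z hz) this).sub ((d₀ z hz).const_mul (K / 2))).congr_deriv ?_
      rw [hode z hz, ← hK z hz]
      field_simp
      ring
  obtain ⟨b, hb⟩ := hU.exists_const_of_hasDerivAt_zero hconn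
    (F := fun z => f z * (deriv (deriv f) z / deriv f z ^ 2) - a * z) fun z hz => by
      have := hf' z hz
      refine (((d₀ z hz).mul (hQ z hz)).sub (lin a z)).congr_deriv ?_
      rw [← ha z hz]
      field_simp
      ring
  exact ⟨K, a, b, d, fun z hz =>
    ⟨hK z hz, by linear_combination hd z hz, by linear_combination hb z hz⟩⟩

/--
Let `U ⊆ ℂ` be a nonempty connected open set and let `f` be holomorphic
on `U` with `f′` nonvanishing on `U`. Then the Schwarzian derivative `S(f)` vanishes
identically on `U` if and only if `f` is the restriction to `U` of a Möbius
transformation: there exist `a, b, c, d ∈ ℂ` with `ad − bc ≠ 0` such that `cz + d ≠ 0`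
and `f(z) = (az + b)/(cz + d)` for every `z ∈ U`.
-/
theorem stmt7 (U : Set ℂ) (hU : IsOpen U) (hconn : IsConnected U)
    (f : ℂ → ℂ) (hf : DifferentiableOn ℂ f U)
    (hf' : ∀ z ∈ U, deriv f z ≠ 0) :
    (∀ z ∈ U, schwarzian f z = 0) ↔
      ∃ a b c d : ℂ, a * d - b * c ≠ 0 ∧
        ∀ z ∈ U, c * z + d ≠ 0 ∧ f z = (a * z + b) / (c * z + d) := by
  obtain ⟨z₀, hz₀⟩ := hconn.nonempty
  have der {F : ℂ → ℂ} (hF : DifferentiableOn ℂ F U) (z : ℂ) (hz : z ∈ U) :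
      HasDerivAt F (deriv F z) z := (hF.differentiableAt (hU.mem_nhds hz)).hasDerivAt
  constructor
  · intro hS
    suffices ∃ a b c d : ℂ, ∀ z ∈ U, c * z + d ≠ 0 ∧ f z * (c * z + d) = a * z + b by
      obtain ⟨a, b, c, d, h⟩ := this
      refine ⟨a, b, c, d, ?_, fun z hz => ⟨(h z hz).1, (eq_div_iff (h z hz).1).2 (h z hz).2⟩⟩
      rw [← deriv_mul_sq_of_mul_eq hU (fun z hz => (h z hz).2) hz₀ (der hf z₀ hz₀)]
      exact mul_ne_zero (hf' z₀ hz₀) (pow_ne_zero 2 (h z₀ hz₀).1)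
    obtain ⟨K, a, b, d, h⟩ :=
      exists_affine_of_schwarzian_eq_zero hU hconn.isPreconnected hf hf' hS
    by_cases hK : K = 0
    · have h₂ : ∀ z ∈ U, deriv (deriv f) z = 0 := fun z hz => by
        simpa [hK, hf' z hz] using (h z hz).1
      obtain ⟨k, hk⟩ := hU.exists_const_of_hasDerivAt_zero hconn.isPreconnected
        (F := deriv f) fun z hz => (der (hf.deriv hU) z hz).congr_deriv (h₂ z hz)
      obtain ⟨l, hl⟩ := hU.exists_const_of_hasDerivAt_zero hconn.isPreconnected
        (F := fun z => f z - k * z) fun z hz =>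
          ((der hf z hz).sub ((hasDerivAt_id z).const_mul k)).congr_deriv (by simp [hk z hz])
      exact ⟨k, l, 0, 1, fun z hz => ⟨by simp, by linear_combination hl z hz⟩⟩
    · refine ⟨a, b, -K / 2, d, fun z hz => ?_⟩
      obtain ⟨h₁, h₂, h₃⟩ := h z hz
      rw [← h₂]
      refine ⟨fun h₀ => hK ?_, h₃⟩
      have : deriv (deriv f) z = 0 := by simpa [hf' z hz] using h₀
      simpa [this] using h₁.symm
  · rintro ⟨a, b, c, d, -, h⟩ z hz
    exact schwarzian_eq_zero_of_eqOn_div hU (fun z hz => (h z hz).1)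
      (fun z hz => (h z hz).2) hz
end
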